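/- arXiv:1801.03186 — 2 statements merged into one kernel-verified Lean document; each statement's English description precedes it below -/
import Mathlib

section
/- Let d ≥ 1, N ≥ 1, and let ρ₀,…,ρ_N be Borel probability measures on ℝ^d with finite second moments. Then the infimum of ∫ 𝒞(x₀,…,x_N) dπ(x₀,…,x_N) over all π ∈ Π(ρ₀,…,ρ_N) is attained by some π̂ ∈ Π(ρ₀,…,ρ_N). -/
open MeasureTheory

noncomputable section

/-- `𝒞(x₀,…,x_N)`: the infimum of `∫₀^N ‖X''‖²` over all C² curves `X` with
`X(i) = x i` for every `i = 0, …, N`. -/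
def multiCost {d : ℕ} (N : ℕ) (x : Fin (N + 1) → EuclideanSpace ℝ (Fin d)) : ℝ :=
  sInf { y : ℝ | ∃ X : ℝ → EuclideanSpace ℝ (Fin d), ContDiff ℝ 2 X ∧
      (∀ i : Fin (N + 1), X ((i : ℕ) : ℝ) = x i) ∧
      y = ∫ t in (0:ℝ)..(N:ℝ), ‖deriv (deriv X) t‖ ^ 2 }

open Filter Topology Set
open scoped NNReal ENNReal

section Coupling

/-- The integral of a nonnegative continuous function is weakly lower semicontinuous in the
probability measure. -/
theorem lowerSemicontinuous_lintegral_ofReal {α : Type*} [TopologicalSpace α] [MeasurableSpace α]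
    [OpensMeasurableSpace α] {f : α → ℝ} (hf : Continuous f) :
    LowerSemicontinuous fun μ : ProbabilityMeasure α => ∫⁻ x, ENNReal.ofReal (f x) ∂μ := by
  have hg : ∀ n : ℕ, Continuous fun x => min (f x).toNNReal (n : ℝ≥0) := fun n =>
    (continuous_real_toNNReal.comp hf).min continuous_const
  let g : ℕ → BoundedContinuousFunction α ℝ≥0 := fun n =>
    BoundedContinuousFunction.mkOfBound ⟨_, hg n⟩ n (by
      intro x y
      rw [NNReal.dist_eq]
      have hx : ((min (f x).toNNReal (n : ℝ≥0) : ℝ≥0) : ℝ) ≤ n := by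
        exact_mod_cast min_le_right (f x).toNNReal (n : ℝ≥0)
      have hy : ((min (f y).toNNReal (n : ℝ≥0) : ℝ≥0) : ℝ) ≤ n := by
        exact_mod_cast min_le_right (f y).toNNReal (n : ℝ≥0)
      exact abs_sub_le_of_nonneg_of_le (NNReal.coe_nonneg _) hx (NNReal.coe_nonneg _) hy)
  have hsup : ∀ μ : ProbabilityMeasure α,
      ∫⁻ x, ENNReal.ofReal (f x) ∂μ = ⨆ n, ∫⁻ x, (g n x : ℝ≥0∞) ∂μ := by
    intro μ
    rw [← lintegral_iSup]
    · refine lintegral_congr fun x => le_antisymm ?_ (iSup_le fun n => ?_)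
      · obtain ⟨n, hn⟩ := exists_nat_ge (f x).toNNReal
        refine le_trans ?_ (le_iSup _ n)
        exact ENNReal.coe_le_coe.2 (le_min le_rfl hn)
      · exact ENNReal.coe_le_coe.2 (min_le_left _ _)
    · exact fun n => (g n).continuous.measurable.coe_nnreal_ennreal
    · exact fun m n hmn x => ENNReal.coe_le_coe.2 (min_le_min_left _ (by exact_mod_cast hmn))
  simp_rw [hsup]
  exact lowerSemicontinuous_iSup fun n =>
    (ProbabilityMeasure.continuous_lintegral_boundedContinuousFunction (g n)).lowerSemicontinuous

variable {ι E : Type*} [Fintype ι] [TopologicalSpace E] [PolishSpace E] [MeasurableSpace E]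
  [BorelSpace E]

/-- Measures on a finite product of Polish spaces with prescribed marginals form a tight set. -/
theorem isTightMeasureSet_setOf_map_eval_eq (ρ : ι → Measure E) [∀ i, IsFiniteMeasure (ρ i)] :
    IsTightMeasureSet {π : Measure (ι → E) | ∀ i, π.map (fun y => y i) = ρ i} := by
  rw [isTightMeasureSet_iff_exists_isCompact_measure_compl_le]
  intro ε hε
  obtain ⟨δ, hδ, hδε⟩ := ENNReal.exists_pos_sum_of_countable hε.ne' ι
  have hK : ∀ i, ∃ K : Set E, IsCompact K ∧ ρ i Kᶜ ≤ δ i := fun i => by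
    obtain ⟨K, hK, h⟩ := isTightMeasureSet_iff_exists_isCompact_measure_compl_le.1
      (isTightMeasureSet_singleton (μ := ρ i)) (δ i) (by exact_mod_cast hδ i)
    exact ⟨K, hK, h _ rfl⟩
  choose K hKc hKδ using hK
  refine ⟨univ.pi K, isCompact_univ_pi hKc, fun π hπ => ?_⟩
  have hcompl : (univ.pi K)ᶜ ⊆ ⋃ i, (fun y : ι → E => y i) ⁻¹' (K i)ᶜ := by
    intro y hy
    simpa [Set.mem_pi] using hy
  calc π (univ.pi K)ᶜ ≤ ∑ i, π ((fun y : ι → E => y i) ⁻¹' (K i)ᶜ) :=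
        (measure_mono hcompl).trans (measure_iUnion_fintype_le _ _)
    _ ≤ ∑ i, (δ i : ℝ≥0∞) := by
        refine Finset.sum_le_sum fun i _ => ?_
        rw [← Measure.map_apply (measurable_pi_apply i) (hKc i).measurableSet.compl, hπ i]
        exact hKδ i
    _ ≤ ε := by rw [← tsum_fintype (L := .unconditional ι)]; exact hδε.le

theorem isCompact_setOf_map_eval_eq (ρ : ι → Measure E) [∀ i, IsProbabilityMeasure (ρ i)] :
    IsCompact {π : ProbabilityMeasure (ι → E) |
      ∀ i, (π : Measure (ι → E)).map (fun y => y i) = ρ i} := by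
  have hclosed : IsClosed {π : ProbabilityMeasure (ι → E) |
      ∀ i, (π : Measure (ι → E)).map (fun y => y i) = ρ i} := by
    let _ := TopologicalSpace.upgradeIsCompletelyMetrizable E
    rw [ofPred_forall]
    refine isClosed_iInter fun i => ?_
    let P : ProbabilityMeasure E := ⟨ρ i, inferInstance⟩
    have hP : IsClosed {P} := isClosed_singleton
    convert hP.preimage
      (ProbabilityMeasure.continuous_map (continuous_apply (A := fun _ : ι => E) i)) using 1
    ext π
    rw [mem_preimage, mem_singleton_iff, ← ProbabilityMeasure.toMeasure_injective.eq_iff,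
      ProbabilityMeasure.toMeasure_map]
    rfl
  rw [← hclosed.closure_eq]
  refine isCompact_closure_of_isTightMeasureSet
    ((isTightMeasureSet_setOf_map_eval_eq ρ).subset ?_)
  rintro _ ⟨π, hπ, rfl⟩
  exact hπ

/-- Existence of optimal couplings for a continuous multimarginal cost. -/
theorem exists_coupling_lintegral_ofReal_le (ρ : ι → Measure E) [∀ i, IsProbabilityMeasure (ρ i)]
    {f : (ι → E) → ℝ} (hf : Continuous f) :
    ∃ π : Measure (ι → E), IsProbabilityMeasure π ∧ (∀ i, π.map (fun y => y i) = ρ i) ∧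
      ∀ π' : Measure (ι → E), IsProbabilityMeasure π' → (∀ i, π'.map (fun y => y i) = ρ i) →
        (∫⁻ y, ENNReal.ofReal (f y) ∂π) ≤ ∫⁻ y, ENNReal.ofReal (f y) ∂π' := by
  have hne : {π : ProbabilityMeasure (ι → E) |
      ∀ i, (π : Measure (ι → E)).map (fun y => y i) = ρ i}.Nonempty :=
    ⟨⟨Measure.pi ρ, inferInstance⟩, fun i => (measurePreserving_eval ρ i).map_eq⟩
  obtain ⟨π, hπ, hmin⟩ := ((lowerSemicontinuous_lintegral_ofReal hf).lowerSemicontinuousOn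
    _).exists_isMinOn hne (isCompact_setOf_map_eval_eq ρ)
  exact ⟨π, inferInstance, hπ, fun π' h' hπ' => isMinOn_iff.1 hmin ⟨π', h'⟩ hπ'⟩

end Coupling

section Cost

variable {d : ℕ}

theorem exists_contDiff_eq_ite_of_nat (i : ℕ) :
    ∃ φ : ℝ → ℝ, ContDiff ℝ 2 φ ∧ ∀ j : ℕ, φ j = if j = i then 1 else 0 := by
  let b : ContDiffBump (i : ℝ) := ⟨1 / 4, 1 / 2, by norm_num, by norm_num⟩
  refine ⟨b, b.contDiff, fun j => ?_⟩
  split_ifs with h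
  · subst h
    exact b.one_of_mem_closedBall (by simp [b])
  · refine b.zero_of_le_dist ?_
    have h1 : (1 : ℝ) ≤ |((j : ℤ) - (i : ℤ) : ℤ)| := by
      exact_mod_cast Int.one_le_abs (sub_ne_zero.2 (Nat.cast_injective.ne h))
    rw [Real.dist_eq]
    push_cast at h1
    change (1 / 2 : ℝ) ≤ _
    linarith

/-- Smooth interpolation with energy controlled by the squared norm of the data. -/
theorem exists_contDiff_interpolation (N : ℕ) : ∃ K : ℝ, 0 ≤ K ∧
    ∀ z : Fin (N + 1) → EuclideanSpace ℝ (Fin d), ∃ Z : ℝ → EuclideanSpace ℝ (Fin d),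
      ContDiff ℝ 2 Z ∧ (∀ i : Fin (N + 1), Z ((i : ℕ) : ℝ) = z i) ∧
      ∫ t in (0:ℝ)..(N:ℝ), ‖deriv (deriv Z) t‖ ^ 2 ≤ K * ‖z‖ ^ 2 := by
  choose φ hφ hφi using exists_contDiff_eq_ite_of_nat
  have hφ' : ∀ i, ContDiff ℝ 1 (deriv (φ i)) := fun i => (hφ i).deriv'
  have hφ'' : ∀ i, Continuous (deriv (deriv (φ i))) := fun i => (hφ' i).continuous_deriv le_rfl
  let B : ℝ → ℝ := fun t => ∑ i : Fin (N + 1), |deriv (deriv (φ i)) t|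
  have hB : Continuous B := continuous_finsetSum _ fun i _ => (hφ'' i).abs
  refine ⟨∫ t in (0:ℝ)..(N:ℝ), B t ^ 2, intervalIntegral.integral_nonneg (by positivity)
    fun t _ => sq_nonneg _, fun z => ?_⟩
  have hd1 : deriv (fun t => ∑ i : Fin (N + 1), φ i t • z i) =
      fun t => ∑ i : Fin (N + 1), deriv (φ i) t • z i := by
    ext1 t
    exact (HasDerivAt.fun_sum fun (i : Fin (N + 1)) _ =>
      (((hφ i).differentiable two_ne_zero) t).hasDerivAt.smul_const (z i)).deriv
  have hd2 : deriv (fun t => ∑ i : Fin (N + 1), deriv (φ i) t • z i) =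
      fun t => ∑ i : Fin (N + 1), deriv (deriv (φ i)) t • z i := by
    ext1 t
    exact (HasDerivAt.fun_sum fun (i : Fin (N + 1)) _ =>
      (((hφ' i).differentiable one_ne_zero) t).hasDerivAt.smul_const (z i)).deriv
  refine ⟨fun t => ∑ i : Fin (N + 1), φ i t • z i,
    ContDiff.sum fun i _ => (hφ i).smul contDiff_const, fun i => ?_, ?_⟩
  · simp [hφi, ← Fin.ext_iff]
  · rw [hd1, hd2, ← intervalIntegral.integral_mul_const]
    refine intervalIntegral.integral_mono_on (by positivity)
      (Continuous.intervalIntegrable (by fun_prop) _ _)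
      (Continuous.intervalIntegrable (by fun_prop) _ _) fun t _ => ?_
    rw [← mul_pow]
    refine pow_le_pow_left₀ (norm_nonneg _) ((norm_sum_le _ _).trans ?_) 2
    rw [Finset.sum_mul]
    refine Finset.sum_le_sum fun i _ => ?_
    rw [norm_smul, Real.norm_eq_abs]
    exact mul_le_mul_of_nonneg_left (norm_le_pi_norm z i) (abs_nonneg _)

theorem norm_add_sq_le_of_pos {E : Type*} [SeminormedAddCommGroup E] (a b : E) {δ : ℝ}
    (hδ : 0 < δ) : ‖a + b‖ ^ 2 ≤ (1 + δ) * ‖a‖ ^ 2 + (1 + δ⁻¹) * ‖b‖ ^ 2 := by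
  have h : 0 ≤ δ⁻¹ * (δ * ‖a‖ - ‖b‖) ^ 2 := by positivity
  have h' : δ⁻¹ * (δ * ‖a‖ - ‖b‖) ^ 2 = δ * ‖a‖ ^ 2 - 2 * (‖a‖ * ‖b‖) + δ⁻¹ * ‖b‖ ^ 2 := by
    field_simp
    ring
  nlinarith [pow_le_pow_left₀ (norm_nonneg _) (norm_add_le a b) 2]

theorem integral_norm_deriv_deriv_add_sq_le {X Z : ℝ → EuclideanSpace ℝ (Fin d)}
    (hX : ContDiff ℝ 2 X) (hZ : ContDiff ℝ 2 Z) {T : ℝ} (hT : 0 ≤ T) {δ : ℝ} (hδ : 0 < δ) :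
    ∫ t in (0:ℝ)..T, ‖deriv (deriv fun s => X s + Z s) t‖ ^ 2 ≤
      (1 + δ) * (∫ t in (0:ℝ)..T, ‖deriv (deriv X) t‖ ^ 2) +
        (1 + δ⁻¹) * ∫ t in (0:ℝ)..T, ‖deriv (deriv Z) t‖ ^ 2 := by
  have hX' : ContDiff ℝ 1 (deriv X) := hX.deriv'
  have hZ' : ContDiff ℝ 1 (deriv Z) := hZ.deriv'
  have hX'' : Continuous (deriv (deriv X)) := hX'.continuous_deriv le_rfl
  have hZ'' : Continuous (deriv (deriv Z)) := hZ'.continuous_deriv le_rfl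
  have hd : deriv (fun s => X s + Z s) = fun s => deriv X s + deriv Z s := by
    ext1 s
    exact deriv_fun_add (hX.differentiable two_ne_zero s) (hZ.differentiable two_ne_zero s)
  have hd' : deriv (fun s => deriv X s + deriv Z s) =
      fun s => deriv (deriv X) s + deriv (deriv Z) s := by
    ext1 s
    exact deriv_fun_add (hX'.differentiable one_ne_zero s) (hZ'.differentiable one_ne_zero s)
  rw [hd, hd', ← intervalIntegral.integral_const_mul, ← intervalIntegral.integral_const_mul,
    ← intervalIntegral.integral_add (Continuous.intervalIntegrable (by fun_prop) _ _)
      (Continuous.intervalIntegrable (by fun_prop) _ _)]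
  exact intervalIntegral.integral_mono_on hT (Continuous.intervalIntegrable (by fun_prop) _ _)
    (Continuous.intervalIntegrable (by fun_prop) _ _) fun t _ => norm_add_sq_le_of_pos _ _ hδ

theorem exists_multiCost_le (d N : ℕ) : ∃ K : ℝ,
    ∀ (x y : Fin (N + 1) → EuclideanSpace ℝ (Fin d)) (δ : ℝ), 0 < δ →
      multiCost N y ≤ (1 + δ) * multiCost N x + (1 + δ⁻¹) * (K * ‖y - x‖ ^ 2) := by
  obtain ⟨K, -, hK⟩ := exists_contDiff_interpolation (d := d) N
  refine ⟨K, fun x y δ hδ => ?_⟩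
  obtain ⟨Z, hZ, hZi, hZK⟩ := hK (y - x)
  have hδ' : 0 < 1 + δ := by positivity
  rw [← sub_le_iff_le_add, ← div_le_iff₀' hδ']
  refine le_csInf ?_ ?_
  · obtain ⟨X, hX, hXi, -⟩ := hK x
    exact ⟨_, X, hX, hXi, rfl⟩
  · rintro _ ⟨X, hX, hXi, rfl⟩
    rw [div_le_iff₀' hδ', sub_le_iff_le_add]
    have hbdd : BddBelow { r : ℝ | ∃ X : ℝ → EuclideanSpace ℝ (Fin d), ContDiff ℝ 2 X ∧
        (∀ i : Fin (N + 1), X ((i : ℕ) : ℝ) = y i) ∧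
        r = ∫ t in (0:ℝ)..(N:ℝ), ‖deriv (deriv X) t‖ ^ 2 } := by
      refine ⟨0, ?_⟩
      rintro _ ⟨X, -, -, rfl⟩
      exact intervalIntegral.integral_nonneg (by positivity) fun t _ => sq_nonneg _
    calc multiCost N y ≤ ∫ t in (0:ℝ)..(N:ℝ), ‖deriv (deriv fun s => X s + Z s) t‖ ^ 2 :=
          csInf_le hbdd ⟨fun s => X s + Z s, hX.add hZ, fun i => by simp [hXi, hZi], rfl⟩
      _ ≤ _ := integral_norm_deriv_deriv_add_sq_le hX hZ (by positivity) hδ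
      _ ≤ _ := by gcongr

theorem continuous_multiCost (d N : ℕ) :
    Continuous (multiCost N : (Fin (N + 1) → EuclideanSpace ℝ (Fin d)) → ℝ) := by
  obtain ⟨K, hK⟩ := exists_multiCost_le d N
  have h_pos : ∀ p : ℝ → Prop, (∀ᶠ δ in 𝓝 (0 : ℝ), p δ) → ∃ δ, 0 < δ ∧ p δ :=
    fun p hp => ((eventually_mem_nhdsWithin (s := Ioi (0 : ℝ))).and
      (hp.filter_mono nhdsWithin_le_nhds)).exists
  rw [continuous_iff_continuousAt]
  intro x
  refine tendsto_order.2 ⟨fun c hc => ?_, fun c hc => ?_⟩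
  · obtain ⟨δ, hδ, hδc⟩ := h_pos (fun δ => (1 + δ) * c < multiCost N x)
      (ContinuousAt.eventually_lt (by fun_prop) continuousAt_const (by simpa using hc))
    have hev : ∀ᶠ y in 𝓝 x,
        (1 + δ) * c + (1 + δ⁻¹) * (K * ‖x - y‖ ^ 2) < multiCost N x :=
      ContinuousAt.eventually_lt (by fun_prop) continuousAt_const (by simpa using hδc)
    filter_upwards [hev] with y hy
    exact lt_of_mul_lt_mul_left (by linarith [hK y x δ hδ]) (by positivity : 0 ≤ 1 + δ)
  · obtain ⟨δ, hδ, hδc⟩ := h_pos (fun δ => (1 + δ) * multiCost N x < c)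
      (ContinuousAt.eventually_lt (by fun_prop) continuousAt_const (by simpa using hc))
    have hev : ∀ᶠ y in 𝓝 x,
        (1 + δ) * multiCost N x + (1 + δ⁻¹) * (K * ‖y - x‖ ^ 2) < c :=
      ContinuousAt.eventually_lt (by fun_prop) continuousAt_const (by simpa using hδc)
    filter_upwards [hev] with y hy
    exact (hK x y δ hδ).trans_lt hy

end Cost

/-- For probability measures `ρ₀,…,ρ_N` on `ℝ^d` with finite second moments, the
multimarginal problem `inf { ∫ 𝒞 dπ : π ∈ Π(ρ₀,…,ρ_N) }` admits a minimizer. -/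
theorem stmt6 (d N : ℕ) (hd : 1 ≤ d) (hN : 1 ≤ N)
    (ρ : Fin (N + 1) → Measure (EuclideanSpace ℝ (Fin d)))
    (hprob : ∀ i, IsProbabilityMeasure (ρ i))
    (hmom : ∀ i, (∫⁻ z, ENNReal.ofReal (‖z‖ ^ 2) ∂(ρ i)) < ⊤) :
    ∃ π : Measure (Fin (N + 1) → EuclideanSpace ℝ (Fin d)),
      IsProbabilityMeasure π ∧ (∀ i, π.map (fun y => y i) = ρ i) ∧
      ∀ π' : Measure (Fin (N + 1) → EuclideanSpace ℝ (Fin d)),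
        IsProbabilityMeasure π' → (∀ i, π'.map (fun y => y i) = ρ i) →
        (∫⁻ y, ENNReal.ofReal (multiCost N y) ∂π) ≤
          ∫⁻ y, ENNReal.ofReal (multiCost N y) ∂π' := by
  exact exists_coupling_lintegral_ofReal_le ρ (continuous_multiCost d N)
end
end

section
/- Let d ≥ 1, N ≥ 1, and let ρ₀,…,ρ_N be Borel probability measures on ℝ^d with finite second moments. Call a probability measure P on Ω = C([0,N];ℝ^d) admissible if it gives full measure to the set of twice continuously differentiable paths and (X_i)_#P = ρ_i for every i = 0,…,N. Then an admissible measure P̂ minimizes the energy ∫_Ω ∫₀^N ‖ω''(t)‖² dt dP(ω) among all admissible measures if and only if both of the following hold: (a) P̂(𝒮₃⁰) = 1, and (b) the joint law π̂ = (X₀,X₁,…,X_N)_#P̂ of the evaluations at the integer times minimizes ∫ 𝒞(x₀,…,x_N) dπ over all π ∈ Π(ρ₀,…,ρ_N). -/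
open MeasureTheory

noncomputable section

/-- The path space `Ω = C([0,N]; ℝ^d)` with the uniform metric. -/
abbrev PathSpace (d N : ℕ) := C(Set.Icc (0:ℝ) (N:ℝ), EuclideanSpace ℝ (Fin d))

instance (d N : ℕ) : MeasurableSpace (PathSpace d N) := borel _
instance (d N : ℕ) : BorelSpace (PathSpace d N) := ⟨rfl⟩

/-- The extension of a path `ω : [0,N] → ℝ^d` to all of `ℝ` by clamping the time
variable to `[0,N]`. -/
def pathExt (d N : ℕ) (ω : PathSpace d N) : ℝ → EuclideanSpace ℝ (Fin d) :=
  fun t => ω (Set.projIcc (0:ℝ) (N:ℝ) (Nat.cast_nonneg N) t)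

/-- The mean-squared acceleration `∫₀^N ‖ω''(t)‖² dt` of a path. -/
def energy (d N : ℕ) (ω : PathSpace d N) : ℝ :=
  ∫ t in (0:ℝ)..(N:ℝ), ‖deriv (deriv (pathExt d N ω)) t‖ ^ 2

/-- The set of twice continuously differentiable paths: restrictions to `[0,N]`
of C² functions on `ℝ`. -/
def C2paths (d N : ℕ) : Set (PathSpace d N) :=
  { ω | ∃ f : ℝ → EuclideanSpace ℝ (Fin d), ContDiff ℝ 2 f ∧
      ∀ t : Set.Icc (0:ℝ) (N:ℝ), ω t = f t }

/-- The set `𝒮₃⁰` of natural splines with knots `0, 1, …, N`. -/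
def Spline30 (d N : ℕ) : Set (PathSpace d N) :=
  { ω | ∃ f : ℝ → EuclideanSpace ℝ (Fin d), ContDiff ℝ 2 f ∧
      (∀ t : Set.Icc (0:ℝ) (N:ℝ), ω t = f t) ∧
      (∀ i : Fin N, ∃ a₀ a₁ a₂ a₃ : EuclideanSpace ℝ (Fin d),
        ∀ t ∈ Set.Icc ((i : ℕ) : ℝ) (((i : ℕ) : ℝ) + 1),
          f t = a₀ + t • a₁ + (t ^ 2) • a₂ + (t ^ 3) • a₃) ∧
      deriv (deriv f) 0 = 0 ∧ deriv (deriv f) (N:ℝ) = 0 }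

section Calculus

variable {E : Type*} [NormedAddCommGroup E] [NormedSpace ℝ E]

lemma ContDiff.hasDerivAt_of_two {f : ℝ → E} (hf : ContDiff ℝ 2 f) (t : ℝ) :
    HasDerivAt f (deriv f t) t :=
  (hf.differentiable (by norm_num) t).hasDerivAt

lemma ContDiff.contDiff_deriv_of_two {f : ℝ → E} (hf : ContDiff ℝ 2 f) :
    ContDiff ℝ 1 (deriv f) := by
  have h : ContDiff ℝ (1 + 1) f := by simpa [one_add_one_eq_two] using hf
  exact (contDiff_succ_iff_deriv.1 h).2.2

lemma ContDiff.hasDerivAt_deriv_of_two {f : ℝ → E} (hf : ContDiff ℝ 2 f) (t : ℝ) :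
    HasDerivAt (deriv f) (deriv (deriv f) t) t :=
  (hf.contDiff_deriv_of_two.differentiable (by norm_num) t).hasDerivAt

lemma ContDiff.continuous_deriv_deriv_of_two {f : ℝ → E} (hf : ContDiff ℝ 2 f) :
    Continuous (deriv (deriv f)) :=
  (contDiff_one_iff_deriv.1 hf.contDiff_deriv_of_two).2

lemma deriv_deriv_eq_of_hasDerivAt {f f₁ f₂ : ℝ → E} (h₁ : ∀ t, HasDerivAt f (f₁ t) t)
    (h₂ : ∀ t, HasDerivAt f₁ (f₂ t) t) : deriv (deriv f) = f₂ := by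
  rw [deriv_eq h₁, deriv_eq h₂]

lemma contDiff_two_of_hasDerivAt {f f₁ f₂ : ℝ → E} (h₁ : ∀ t, HasDerivAt f (f₁ t) t)
    (h₂ : ∀ t, HasDerivAt f₁ (f₂ t) t) (hc : Continuous f₂) : ContDiff ℝ 2 f := by
  have h : ContDiff ℝ (1 + 1) f := by
    refine contDiff_succ_iff_deriv.2 ⟨fun t => (h₁ t).differentiableAt, by simp, ?_⟩
    rw [deriv_eq h₁]
    refine contDiff_one_iff_deriv.2 ⟨fun t => (h₂ t).differentiableAt, ?_⟩
    rwa [deriv_eq h₂]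
  simpa [one_add_one_eq_two] using h

lemma deriv_deriv_eqOn_Ioo {f g : ℝ → E} {a b : ℝ} (h : Set.EqOn f g (Set.Ioo a b)) :
    Set.EqOn (deriv (deriv f)) (deriv (deriv g)) (Set.Ioo a b) :=
  (h.deriv isOpen_Ioo).deriv isOpen_Ioo

lemma deriv_eqOn_Icc {f g : ℝ → E} {a b : ℝ} (hab : a < b) (hf : Continuous (deriv f))
    (hg : Continuous (deriv g)) (h : Set.EqOn f g (Set.Icc a b)) :
    Set.EqOn (deriv f) (deriv g) (Set.Icc a b) := by
  rw [← closure_Ioo hab.ne]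
  exact ((h.mono Set.Ioo_subset_Icc_self).deriv isOpen_Ioo).closure hf hg

lemma deriv_deriv_eqOn_Icc {f g : ℝ → E} {a b : ℝ} (hab : a < b) (hf : ContDiff ℝ 2 f)
    (hg : ContDiff ℝ 2 g) (h : Set.EqOn f g (Set.Icc a b)) :
    Set.EqOn (deriv (deriv f)) (deriv (deriv g)) (Set.Icc a b) :=
  deriv_eqOn_Icc hab hf.continuous_deriv_deriv_of_two hg.continuous_deriv_deriv_of_two <|
    deriv_eqOn_Icc hab hf.contDiff_deriv_of_two.continuous
      hg.contDiff_deriv_of_two.continuous h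

lemma hasDerivAt_max_zero_pow (n : ℕ) (t : ℝ) :
    HasDerivAt (fun t : ℝ => max t 0 ^ (n + 2)) ((n + 2 : ℕ) * max t 0 ^ (n + 1)) t := by
  rcases lt_trichotomy t 0 with ht | rfl | ht
  · have h : (fun t : ℝ => max t 0 ^ (n + 2)) =ᶠ[nhds t] fun _ => 0 := by
      filter_upwards [gt_mem_nhds ht] with s hs
      simp [max_eq_right hs.le]
    simpa [max_eq_right ht.le] using (hasDerivAt_const t (0 : ℝ)).congr_of_eventuallyEq h
  · have hl : HasDerivWithinAt (fun t : ℝ => max t 0 ^ (n + 2)) 0 (Set.Iic 0) 0 :=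
      (hasDerivWithinAt_const (0 : ℝ) _ (0 : ℝ)).congr
        (fun s hs => by simp [max_eq_right (Set.mem_Iic.1 hs)]) (by simp)
    have hr : HasDerivWithinAt (fun t : ℝ => max t 0 ^ (n + 2)) 0 (Set.Ici 0) 0 := by
      refine HasDerivWithinAt.congr (f := fun t : ℝ => t ^ (n + 2)) ?_
        (fun s hs => by simp [max_eq_left (Set.mem_Ici.1 hs)]) (by simp)
      simpa using (hasDerivAt_pow (n + 2) (0 : ℝ)).hasDerivWithinAt
    have h := hl.union hr
    rw [Set.Iic_union_Ici, hasDerivWithinAt_univ] at h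
    simpa using h
  · have h : (fun t : ℝ => max t 0 ^ (n + 2)) =ᶠ[nhds t] fun s => s ^ (n + 2) := by
      filter_upwards [lt_mem_nhds ht] with s hs
      simp [max_eq_left hs.le]
    simpa [max_eq_left ht.le] using (hasDerivAt_pow (n + 2) t).congr_of_eventuallyEq h

/-- A function with vanishing second derivative on `[0,T]` which vanishes at `0` and `1`
vanishes on `[0,T]`. -/
lemma eqOn_zero_of_second_deriv_eq_zero [CompleteSpace E] {h h₁ h₂ : ℝ → E} {T : ℝ} (hT : 1 ≤ T)
    (hh : ∀ t, HasDerivAt h (h₁ t) t) (hh₁ : ∀ t, HasDerivAt h₁ (h₂ t) t)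
    (h_zero : h 0 = 0) (h_one : h 1 = 0) (h₂_zero : Set.EqOn h₂ 0 (Set.Icc 0 T)) :
    Set.EqOn h 0 (Set.Icc 0 T) := by
  have hconst : ∀ t ∈ Set.Icc 0 T, h₁ t = h₁ 0 := by
    intro t ht
    have hz : Set.EqOn h₂ (fun _ => 0) (Set.uIcc 0 t) := fun s hs => by
      rw [Set.uIcc_of_le ht.1] at hs
      exact h₂_zero ⟨hs.1, hs.2.trans ht.2⟩
    have := intervalIntegral.integral_eq_sub_of_hasDerivAt (a := 0) (b := t) (fun s _ => hh₁ s)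
      ((continuousOn_const.congr hz).intervalIntegrable)
    rw [intervalIntegral.integral_congr hz, intervalIntegral.integral_zero] at this
    exact sub_eq_zero.1 this.symm
  have hlin : ∀ t ∈ Set.Icc 0 T, h t = t • h₁ 0 := by
    intro t ht
    have hz : Set.EqOn h₁ (fun _ => h₁ 0) (Set.uIcc 0 t) := fun s hs => by
      rw [Set.uIcc_of_le ht.1] at hs
      exact hconst s ⟨hs.1, hs.2.trans ht.2⟩
    have := intervalIntegral.integral_eq_sub_of_hasDerivAt (a := 0) (b := t) (fun s _ => hh s)
      ((continuousOn_const.congr hz).intervalIntegrable)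
    rw [intervalIntegral.integral_congr hz] at this
    simpa [h_zero] using this.symm
  have h0 : h₁ 0 = 0 := by
    have := hlin 1 ⟨zero_le_one, hT⟩
    rw [h_one] at this
    simpa using this.symm
  intro t ht
  simp [hlin t ht, h0]

omit [NormedSpace ℝ E] in
lemma eqOn_zero_of_integral_norm_sq_eq_zero {u : ℝ → E} (hu : Continuous u) {T : ℝ} (hT : 0 < T)
    (h : ∫ t in (0 : ℝ)..T, ‖u t‖ ^ 2 = 0) : Set.EqOn u 0 (Set.Icc 0 T) := by
  by_contra hne
  simp only [Set.EqOn, not_forall] at hne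
  obtain ⟨t, ht, htu⟩ := hne
  have hpos : 0 < ‖u t‖ ^ 2 := pow_pos (norm_pos_iff.2 htu) 2
  exact (intervalIntegral.integral_pos hT (by fun_prop) (fun _ _ => by positivity)
    ⟨t, ht, hpos⟩).ne' h

end Calculus

section Orthogonality

variable {E : Type*} [NormedAddCommGroup E] [InnerProductSpace ℝ E]

/-- `f` is a natural cubic spline on `[0,N]` with knots `0, 1, …, N`. -/
structure IsNaturalSpline (N : ℕ) (f : ℝ → E) : Prop where
  contDiff : ContDiff ℝ 2 f
  cubic : ∀ i : Fin N, ∃ a₀ a₁ a₂ a₃ : E,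
    ∀ t ∈ Set.Icc ((i : ℕ) : ℝ) (((i : ℕ) : ℝ) + 1),
      f t = a₀ + t • a₁ + (t ^ 2) • a₂ + (t ^ 3) • a₃
  left : deriv (deriv f) 0 = 0
  right : deriv (deriv f) (N : ℝ) = 0

lemma hasDerivAt_cubic (a₀ a₁ a₂ a₃ : E) (t : ℝ) :
    HasDerivAt (fun t : ℝ => a₀ + t • a₁ + (t ^ 2) • a₂ + (t ^ 3) • a₃)
      (a₁ + (2 * t) • a₂ + (3 * t ^ 2) • a₃) t := by
  have h₁ := (hasDerivAt_id t).smul_const a₁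
  have h₂ := (hasDerivAt_pow 2 t).smul_const a₂
  have h₃ := (hasDerivAt_pow 3 t).smul_const a₃
  refine (((h₁.const_add a₀).add h₂).add h₃).congr_deriv ?_
  simp

lemma hasDerivAt_quadratic (a₁ a₂ a₃ : E) (t : ℝ) :
    HasDerivAt (fun t : ℝ => a₁ + (2 * t) • a₂ + (3 * t ^ 2) • a₃)
      ((2 : ℝ) • a₂ + (6 * t) • a₃) t := by
  have h₂ := ((hasDerivAt_id t).const_mul 2).smul_const a₂
  have h₃ := ((hasDerivAt_pow 2 t).const_mul 3).smul_const a₃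
  refine ((h₂.const_add a₁).add h₃).congr_deriv ?_
  simp only [mul_one, Nat.cast_ofNat]
  ring_nf

lemma integral_inner_affine {h h₁ h₂ : ℝ → E} (hh : ∀ t, HasDerivAt h (h₁ t) t)
    (hh₁ : ∀ t, HasDerivAt h₁ (h₂ t) t) (hc : Continuous h₂) (p q : E) (a b : ℝ) :
    ∫ t in a..b, inner ℝ (p + (6 * t) • q) (h₂ t) =
      (inner ℝ (p + (6 * b) • q) (h₁ b) - inner ℝ ((6 : ℝ) • q) (h b)) -
        (inner ℝ (p + (6 * a) • q) (h₁ a) - inner ℝ ((6 : ℝ) • q) (h a)) := by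
  refine intervalIntegral.integral_eq_sub_of_hasDerivAt
    (f := fun t => inner ℝ (p + (6 * t) • q) (h₁ t) - inner ℝ ((6 : ℝ) • q) (h t))
    (fun t _ => ?_) (Continuous.intervalIntegrable (by fun_prop) _ _)
  have hl : HasDerivAt (fun t : ℝ => p + (6 * t) • q) ((6 : ℝ) • q) t := by
    simpa using (((hasDerivAt_id t).const_mul 6).smul_const q).const_add p
  refine ((hl.inner ℝ (hh₁ t)).sub ((hasDerivAt_const t ((6 : ℝ) • q)).inner ℝ (hh t))).congr_deriv
    ?_
  simp

/-- The second derivative of a natural spline is orthogonal to the second derivative of every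
curve vanishing at the knots. -/
lemma IsNaturalSpline.integral_inner_eq_zero {N : ℕ} {f : ℝ → E} (hf : IsNaturalSpline N f)
    {h h₁ h₂ : ℝ → E} (hh : ∀ t, HasDerivAt h (h₁ t) t)
    (hh₁ : ∀ t, HasDerivAt h₁ (h₂ t) t) (hc : Continuous h₂)
    (hknot : ∀ i : Fin (N + 1), h ((i : ℕ) : ℝ) = 0) :
    ∫ t in (0 : ℝ)..N, inner ℝ (deriv (deriv f) t) (h₂ t) = 0 := by
  have hf₂ := hf.contDiff.continuous_deriv_deriv_of_two
  have hsum := intervalIntegral.sum_integral_adjacent_intervals (n := N) (a := fun k : ℕ => (k : ℝ))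
    (f := fun t => inner ℝ (deriv (deriv f) t) (h₂ t)) (μ := volume)
    (fun k _ => Continuous.intervalIntegrable (by fun_prop) _ _)
  have hpiece : ∀ k ∈ Finset.range N,
      ∫ t in (k : ℝ)..((k + 1 : ℕ) : ℝ), inner ℝ (deriv (deriv f) t) (h₂ t) =
        inner ℝ (deriv (deriv f) ((k + 1 : ℕ) : ℝ)) (h₁ ((k + 1 : ℕ) : ℝ)) -
          inner ℝ (deriv (deriv f) (k : ℝ)) (h₁ (k : ℝ)) := by
    intro k hk
    have hkN := Finset.mem_range.1 hk
    obtain ⟨a₀, a₁, a₂, a₃, ha⟩ := hf.cubic ⟨k, hkN⟩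
    have hcub := contDiff_two_of_hasDerivAt (hasDerivAt_cubic a₀ a₁ a₂ a₃)
      (hasDerivAt_quadratic a₁ a₂ a₃) (by fun_prop)
    have heq := deriv_deriv_eqOn_Icc (lt_add_one (k : ℝ)) hf.contDiff hcub ha
    rw [deriv_deriv_eq_of_hasDerivAt (hasDerivAt_cubic a₀ a₁ a₂ a₃)
      (hasDerivAt_quadratic a₁ a₂ a₃)] at heq
    have hk0 : h (k : ℝ) = 0 := hknot ⟨k, by omega⟩
    have hk1 : h ((k + 1 : ℕ) : ℝ) = 0 := hknot ⟨k + 1, by omega⟩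
    have hle : (k : ℝ) ≤ ((k + 1 : ℕ) : ℝ) := by simp
    rw [intervalIntegral.integral_congr
      (g := fun t => inner ℝ ((2 : ℝ) • a₂ + (6 * t) • a₃) (h₂ t)),
      integral_inner_affine hh hh₁ hc, hk0, hk1, heq (x := (k : ℝ)) (by simp),
      heq (x := ((k + 1 : ℕ) : ℝ)) (by simp)]
    · simp
    · intro t ht
      rw [Set.uIcc_of_le hle] at ht
      simp only
      rw [heq (by simpa using ht)]
  rw [Finset.sum_congr rfl hpiece,
    Finset.sum_range_sub (fun k : ℕ => inner ℝ (deriv (deriv f) (k : ℝ)) (h₁ (k : ℝ)))] at hsum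
  simpa [hf.left, hf.right] using hsum.symm

/-- Pythagorean identity for the acceleration of a curve interpolated by a natural spline. -/
lemma IsNaturalSpline.integral_norm_sq_eq {N : ℕ} {f g : ℝ → E} (hf : IsNaturalSpline N f)
    (hg : ContDiff ℝ 2 g) (hknot : ∀ i : Fin (N + 1), g ((i : ℕ) : ℝ) = f ((i : ℕ) : ℝ)) :
    ∫ t in (0 : ℝ)..N, ‖deriv (deriv g) t‖ ^ 2 =
      (∫ t in (0 : ℝ)..N, ‖deriv (deriv f) t‖ ^ 2) +
        ∫ t in (0 : ℝ)..N, ‖deriv (deriv g) t - deriv (deriv f) t‖ ^ 2 := by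
  have hf₂ := hf.contDiff.continuous_deriv_deriv_of_two
  have hg₂ := hg.continuous_deriv_deriv_of_two
  have horth := hf.integral_inner_eq_zero
    (fun t => (hg.hasDerivAt_of_two t).sub (hf.contDiff.hasDerivAt_of_two t))
    (fun t => (hg.hasDerivAt_deriv_of_two t).sub (hf.contDiff.hasDerivAt_deriv_of_two t))
    (hg₂.sub hf₂) (fun i => by simp [hknot i])
  have hexp : ∀ t, ‖deriv (deriv g) t‖ ^ 2 = ‖deriv (deriv f) t‖ ^ 2 +
      2 * inner ℝ (deriv (deriv f) t) (deriv (deriv g) t - deriv (deriv f) t) +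
        ‖deriv (deriv g) t - deriv (deriv f) t‖ ^ 2 := fun t => by
    rw [← norm_add_sq_real, add_sub_cancel]
  simp_rw [hexp]
  rw [intervalIntegral.integral_add (Continuous.intervalIntegrable (by fun_prop) _ _)
      (Continuous.intervalIntegrable (by fun_prop) _ _),
    intervalIntegral.integral_add (Continuous.intervalIntegrable (by fun_prop) _ _)
      (Continuous.intervalIntegrable (by fun_prop) _ _),
    intervalIntegral.integral_const_mul]
  rw [horth]
  ring

/-- A curve with the same acceleration energy as its interpolating natural spline is that
spline. -/
lemma IsNaturalSpline.eqOn_of_integral_le [CompleteSpace E] {N : ℕ} (hN : 1 ≤ N) {f g : ℝ → E}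
    (hf : IsNaturalSpline N f) (hg : ContDiff ℝ 2 g)
    (hknot : ∀ i : Fin (N + 1), g ((i : ℕ) : ℝ) = f ((i : ℕ) : ℝ))
    (hle : ∫ t in (0 : ℝ)..N, ‖deriv (deriv g) t‖ ^ 2 ≤
      ∫ t in (0 : ℝ)..N, ‖deriv (deriv f) t‖ ^ 2) :
    Set.EqOn g f (Set.Icc 0 (N : ℝ)) := by
  have hN' : (1 : ℝ) ≤ N := by exact_mod_cast hN
  have hf₂ := hf.contDiff.continuous_deriv_deriv_of_two
  have hg₂ := hg.continuous_deriv_deriv_of_two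
  have hnn : 0 ≤ ∫ t in (0 : ℝ)..N, ‖deriv (deriv g) t - deriv (deriv f) t‖ ^ 2 :=
    intervalIntegral.integral_nonneg (by positivity) fun _ _ => by positivity
  have hzero := eqOn_zero_of_integral_norm_sq_eq_zero
    (u := fun t => deriv (deriv g) t - deriv (deriv f) t) (hg₂.sub hf₂) (zero_lt_one.trans_le hN')
    (le_antisymm (by linarith [hf.integral_norm_sq_eq hg hknot]) hnn)
  have h0 := hknot 0
  have h1 := hknot ⟨1, by omega⟩
  simp only [Fin.val_zero, Nat.cast_zero, Nat.cast_one] at h0 h1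
  have := eqOn_zero_of_second_deriv_eq_zero hN'
    (fun t => (hg.hasDerivAt_of_two t).sub (hf.contDiff.hasDerivAt_of_two t))
    (fun t => (hg.hasDerivAt_deriv_of_two t).sub (hf.contDiff.hasDerivAt_deriv_of_two t))
    (by simp [h0]) (by simp [h1]) hzero
  exact fun t ht => sub_eq_zero.1 (this ht)

end Orthogonality

section Interpolation

variable {E : Type*} [NormedAddCommGroup E] [InnerProductSpace ℝ E]

/-- Coefficients `(c, a, b)` of a cubic spline in truncated power form. -/
abbrev SplineCoeff (E : Type*) (N : ℕ) := (Fin (N + 1) → E) × E × E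

/-- The cubic spline `t ↦ a + t b + ∑ⱼ (t - j)₊³ cⱼ`. -/
def truncatedSpline {N : ℕ} (w : SplineCoeff E N) (t : ℝ) : E :=
  w.2.1 + t • w.2.2 + ∑ j : Fin (N + 1), (max (t - (j : ℕ)) 0 ^ 3) • w.1 j

/-- The first derivative of `truncatedSpline`. -/
def truncatedSplineDeriv {N : ℕ} (w : SplineCoeff E N) (t : ℝ) : E :=
  w.2.2 + ∑ j : Fin (N + 1), (3 * max (t - (j : ℕ)) 0 ^ 2) • w.1 j

/-- The second derivative of `truncatedSpline`. -/
def truncatedSplineDeriv₂ {N : ℕ} (w : SplineCoeff E N) (t : ℝ) : E :=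
  ∑ j : Fin (N + 1), (6 * max (t - (j : ℕ)) 0) • w.1 j

lemma hasDerivAt_max_sub_pow (n j : ℕ) (t : ℝ) :
    HasDerivAt (fun t : ℝ => max (t - j) 0 ^ (n + 2)) ((n + 2 : ℕ) * max (t - j) 0 ^ (n + 1)) t :=
  (hasDerivAt_max_zero_pow n (t - j)).comp_sub_const t (j : ℝ)

lemma hasDerivAt_truncatedSpline {N : ℕ} (w : SplineCoeff E N) (t : ℝ) :
    HasDerivAt (truncatedSpline w) (truncatedSplineDeriv w t) t := by
  have h := (((hasDerivAt_id t).smul_const w.2.2).const_add w.2.1).add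
    (HasDerivAt.fun_sum (u := Finset.univ) fun (j : Fin (N + 1)) _ =>
      (hasDerivAt_max_sub_pow 1 j t).smul_const (w.1 j))
  refine HasDerivAt.congr_deriv (f := truncatedSpline w) h ?_
  simp [truncatedSplineDeriv]

lemma hasDerivAt_truncatedSplineDeriv {N : ℕ} (w : SplineCoeff E N) (t : ℝ) :
    HasDerivAt (truncatedSplineDeriv w) (truncatedSplineDeriv₂ w t) t := by
  have h := (HasDerivAt.fun_sum (u := Finset.univ) fun (j : Fin (N + 1)) _ =>
      (((hasDerivAt_max_sub_pow 0 j t).const_mul 3).smul_const (w.1 j))).const_add w.2.2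
  refine HasDerivAt.congr_deriv (f := truncatedSplineDeriv w) h (Finset.sum_congr rfl fun j _ => ?_)
  congr 1
  push_cast
  ring

lemma continuous_truncatedSpline (N : ℕ) :
    Continuous fun p : SplineCoeff E N × ℝ => truncatedSpline p.1 p.2 := by
  unfold truncatedSpline
  fun_prop

lemma continuous_truncatedSplineDeriv₂ (N : ℕ) :
    Continuous fun p : SplineCoeff E N × ℝ => truncatedSplineDeriv₂ p.1 p.2 := by
  unfold truncatedSplineDeriv₂
  fun_prop

lemma contDiff_truncatedSpline {N : ℕ} (w : SplineCoeff E N) :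
    ContDiff ℝ 2 (truncatedSpline w) :=
  contDiff_two_of_hasDerivAt (hasDerivAt_truncatedSpline w) (hasDerivAt_truncatedSplineDeriv w)
    ((continuous_truncatedSplineDeriv₂ N).comp (Continuous.prodMk_right w))

lemma deriv_deriv_truncatedSpline {N : ℕ} (w : SplineCoeff E N) :
    deriv (deriv (truncatedSpline w)) = truncatedSplineDeriv₂ w :=
  deriv_deriv_eq_of_hasDerivAt (hasDerivAt_truncatedSpline w) (hasDerivAt_truncatedSplineDeriv w)

lemma truncatedSpline_cubic {N : ℕ} (w : SplineCoeff E N) (i : Fin N) :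
    ∃ a₀ a₁ a₂ a₃ : E, ∀ t ∈ Set.Icc ((i : ℕ) : ℝ) (((i : ℕ) : ℝ) + 1),
      truncatedSpline w t = a₀ + t • a₁ + (t ^ 2) • a₂ + (t ^ 3) • a₃ := by
  have hterm : ∀ j : Fin (N + 1), ∃ a₀ a₁ a₂ a₃ : E,
      ∀ t ∈ Set.Icc ((i : ℕ) : ℝ) (((i : ℕ) : ℝ) + 1),
        (max (t - (j : ℕ)) 0 ^ 3) • w.1 j = a₀ + t • a₁ + (t ^ 2) • a₂ + (t ^ 3) • a₃ := by
    intro j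
    rcases le_or_gt (j : ℕ) (i : ℕ) with hji | hij
    · have hji' : ((j : ℕ) : ℝ) ≤ (i : ℕ) := by exact_mod_cast hji
      refine ⟨(-((j : ℕ) : ℝ) ^ 3) • w.1 j, (3 * ((j : ℕ) : ℝ) ^ 2) • w.1 j,
        (-3 * ((j : ℕ) : ℝ)) • w.1 j, w.1 j, fun t ht => ?_⟩
      rw [max_eq_left (by linarith [ht.1])]
      module
    · have hij' : ((i : ℕ) : ℝ) + 1 ≤ (j : ℕ) := by exact_mod_cast hij
      refine ⟨0, 0, 0, 0, fun t ht => ?_⟩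
      rw [max_eq_right (by linarith [ht.2])]
      simp
  choose a₀ a₁ a₂ a₃ ha using hterm
  refine ⟨w.2.1 + ∑ j, a₀ j, w.2.2 + ∑ j, a₁ j, ∑ j, a₂ j, ∑ j, a₃ j, fun t ht => ?_⟩
  rw [truncatedSpline, Finset.sum_congr rfl fun j _ => ha j t ht]
  simp only [Finset.sum_add_distrib, ← Finset.smul_sum]
  module

lemma truncatedSplineDeriv₂_zero {N : ℕ} (w : SplineCoeff E N) :
    truncatedSplineDeriv₂ w 0 = 0 := by
  simp [truncatedSplineDeriv₂]

lemma truncatedSplineDeriv₂_natCast {N : ℕ} (w : SplineCoeff E N) :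
    truncatedSplineDeriv₂ w N = (6 : ℝ) • ∑ j : Fin (N + 1), ((N : ℝ) - (j : ℕ)) • w.1 j := by
  rw [truncatedSplineDeriv₂, Finset.smul_sum]
  refine Finset.sum_congr rfl fun j _ => ?_
  have : ((j : ℕ) : ℝ) ≤ N := by exact_mod_cast Nat.lt_succ_iff.1 j.2
  rw [max_eq_left (by linarith), smul_smul]

/-- The values at the knots of a truncated power spline, together with the two linear
constraints characterising naturality and vanishing cubic coefficient beyond the last knot. -/
def splineSystem (E : Type*) [NormedAddCommGroup E] [InnerProductSpace ℝ E] (N : ℕ) :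
    SplineCoeff E N →ₗ[ℝ] SplineCoeff E N where
  toFun w := (fun i => truncatedSpline w ((i : ℕ) : ℝ), ∑ j : Fin (N + 1), ((N : ℝ) - (j : ℕ)) • w.1 j,
    ∑ j, w.1 j)
  map_add' v w := by
    refine Prod.ext (funext fun i => ?_) (Prod.ext ?_ ?_)
    · simp only [truncatedSpline, Prod.fst_add, Prod.snd_add, Pi.add_apply, smul_add,
        Finset.sum_add_distrib]
      abel
    · simp [Finset.sum_add_distrib]
    · simp [Finset.sum_add_distrib]
  map_smul' r w := by
    refine Prod.ext (funext fun i => ?_) (Prod.ext ?_ ?_)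
    · simp [truncatedSpline, Finset.smul_sum, smul_comm r]
    · simp [Finset.smul_sum, smul_comm r]
    · simp [Finset.smul_sum]

lemma isNaturalSpline_truncatedSpline {N : ℕ} {w : SplineCoeff E N}
    (hw : ∑ j : Fin (N + 1), ((N : ℝ) - (j : ℕ)) • w.1 j = 0) : IsNaturalSpline N (truncatedSpline w) where
  contDiff := contDiff_truncatedSpline w
  cubic := truncatedSpline_cubic w
  left := by rw [deriv_deriv_truncatedSpline, truncatedSplineDeriv₂_zero]
  right := by rw [deriv_deriv_truncatedSpline, truncatedSplineDeriv₂_natCast, hw, smul_zero]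

lemma splineSystem_injective [CompleteSpace E] {N : ℕ} (hN : 1 ≤ N) :
    Function.Injective (splineSystem E N) := by
  rw [injective_iff_map_eq_zero]
  intro w hw
  simp only [splineSystem, LinearMap.coe_mk, AddHom.coe_mk, Prod.mk_eq_zero] at hw
  obtain ⟨hknot, hnat, hsum⟩ := hw
  have hN' : (0 : ℝ) < N := by exact_mod_cast hN
  have hs := isNaturalSpline_truncatedSpline hnat
  have hcont := (continuous_truncatedSplineDeriv₂ N).comp (Continuous.prodMk_right w)
  have horth := hs.integral_inner_eq_zero (hasDerivAt_truncatedSpline w)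
    (hasDerivAt_truncatedSplineDeriv w) hcont (fun i => congrFun hknot i)
  simp only [deriv_deriv_truncatedSpline, real_inner_self_eq_norm_sq] at horth
  have hzero := eqOn_zero_of_integral_norm_sq_eq_zero hcont hN' horth
  have hc : ∀ k : ℕ, ∀ hk : k < N, w.1 ⟨k, by omega⟩ = 0 := by
    intro k
    induction k using Nat.strong_induction_on with
    | _ k ih =>
      intro hk
      have hk1 : ((k : ℝ) + 1) ≤ N := by exact_mod_cast hk
      have h := hzero (x := (k : ℝ) + 1) ⟨by positivity, hk1⟩
      simp only [Function.comp_apply, truncatedSplineDeriv₂, Pi.zero_apply] at h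
      rw [Finset.sum_eq_single (⟨k, by omega⟩ : Fin (N + 1))] at h
      · simpa using h
      · intro j _ hj
        have hj' : (j : ℕ) ≠ k := fun h => hj (Fin.ext h)
        rcases lt_or_gt_of_ne hj' with hlt | hgt
        · have := ih j hlt (by omega)
          simp only [Fin.eta] at this
          simp [this]
        · have : (k : ℝ) + 1 ≤ (j : ℕ) := by exact_mod_cast hgt
          rw [max_eq_right (by linarith)]
          simp
      · simp
  have hc_all : w.1 = 0 := by
    have hlast : w.1 (Fin.last N) = 0 := by
      have hfirst : ∑ j : Fin N, w.1 j.castSucc = 0 := Finset.sum_eq_zero fun j _ => hc j j.2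
      rwa [Fin.sum_univ_castSucc, hfirst, zero_add] at hsum
    funext j
    rcases Nat.lt_succ_iff_lt_or_eq.1 j.2 with hj | hj
    · exact hc j hj
    · rw [show j = Fin.last N from Fin.ext hj, hlast]
      rfl
  have h0 := congrFun hknot 0
  have h1 := congrFun hknot ⟨1, by omega⟩
  simp only [truncatedSpline, hc_all, Fin.val_zero, Nat.cast_zero, Nat.cast_one, Pi.zero_apply,
    smul_zero, Finset.sum_const_zero, zero_smul, add_zero, one_smul] at h0 h1
  rw [h0, zero_add] at h1
  exact Prod.ext hc_all (Prod.ext h0 h1)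

lemma exists_spline_coeff [FiniteDimensional ℝ E] {N : ℕ} (hN : 1 ≤ N) :
    ∃ L : (Fin (N + 1) → E) →L[ℝ] SplineCoeff E N, ∀ x,
      IsNaturalSpline N (truncatedSpline (L x)) ∧
        ∀ i : Fin (N + 1), truncatedSpline (L x) ((i : ℕ) : ℝ) = x i := by
  have := FiniteDimensional.complete ℝ E
  obtain ⟨R, hR⟩ := (splineSystem E N).exists_rightInverse_of_surjective
    (LinearMap.range_eq_top.2
      (LinearMap.injective_iff_surjective.1 (splineSystem_injective hN)))
  refine ⟨LinearMap.toContinuousLinearMap (R ∘ₗ LinearMap.inl ℝ _ _), fun x => ?_⟩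
  have h := LinearMap.congr_fun hR (x, 0)
  simp only [LinearMap.comp_apply, LinearMap.id_apply, splineSystem, LinearMap.coe_mk,
    AddHom.coe_mk, Prod.ext_iff, Prod.fst_zero] at h
  exact ⟨isNaturalSpline_truncatedSpline h.2.1, fun i => congrFun h.1 i⟩

lemma norm_truncatedSplineDeriv₂_le {N : ℕ} (w : SplineCoeff E N) {t : ℝ}
    (ht : t ∈ Set.Icc 0 (N : ℝ)) :
    ‖truncatedSplineDeriv₂ w t‖ ≤ (N + 1) * (6 * N) * ‖w‖ := by
  have hterm : ∀ j ∈ (Finset.univ : Finset (Fin (N + 1))),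
      ‖(6 * max (t - (j : ℕ)) 0) • w.1 j‖ ≤ 6 * N * ‖w‖ := by
    intro j _
    have hj : (0 : ℝ) ≤ (j : ℕ) := Nat.cast_nonneg _
    have hmax : max (t - (j : ℕ)) 0 ≤ (N : ℝ) := max_le (by linarith [ht.2]) (by positivity)
    have hw : ‖w.1 j‖ ≤ ‖w‖ := (norm_le_pi_norm w.1 j).trans (norm_fst_le w)
    rw [norm_smul, Real.norm_of_nonneg (by positivity)]
    gcongr
  refine (norm_sum_le_of_le _ hterm).trans_eq ?_
  simp
  ring

end Interpolation

section Paths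

variable {d N : ℕ}

/-- The values of a path at the knots `0, 1, …, N`. -/
def knotValues (d N : ℕ) (ω : PathSpace d N) (i : Fin (N + 1)) : EuclideanSpace ℝ (Fin d) :=
  pathExt d N ω ((i : ℕ) : ℝ)

/-- The restriction to `[0,N]` of a continuous function on `ℝ`. -/
def restrictPath {f : ℝ → EuclideanSpace ℝ (Fin d)} (hf : Continuous f) : PathSpace d N :=
  ⟨fun t => f t, hf.comp continuous_subtype_val⟩

lemma continuous_pathExt_apply (t : ℝ) : Continuous fun ω : PathSpace d N => pathExt d N ω t :=
  continuous_eval_const _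

lemma continuous_knotValues : Continuous (knotValues d N) :=
  continuous_pi fun _ => continuous_pathExt_apply _

lemma pathExt_of_mem {ω : PathSpace d N} {f : ℝ → EuclideanSpace ℝ (Fin d)}
    (h : ∀ t : Set.Icc (0 : ℝ) (N : ℝ), ω t = f t) : Set.EqOn (pathExt d N ω) f (Set.Icc 0 N) := by
  intro t ht
  rw [pathExt, Set.projIcc_of_mem _ ht, h]

lemma knotValues_eq {ω : PathSpace d N} {f : ℝ → EuclideanSpace ℝ (Fin d)}
    (h : ∀ t : Set.Icc (0 : ℝ) (N : ℝ), ω t = f t) (i : Fin (N + 1)) :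
    knotValues d N ω i = f ((i : ℕ) : ℝ) :=
  pathExt_of_mem h ⟨Nat.cast_nonneg _, by exact_mod_cast Nat.lt_succ_iff.1 i.2⟩

lemma energy_eq {ω : PathSpace d N} {f : ℝ → EuclideanSpace ℝ (Fin d)}
    (h : ∀ t : Set.Icc (0 : ℝ) (N : ℝ), ω t = f t) :
    energy d N ω = ∫ t in (0 : ℝ)..N, ‖deriv (deriv f) t‖ ^ 2 := by
  refine intervalIntegral.integral_congr_Ioo_of_le (Nat.cast_nonneg N) fun t ht => ?_
  rw [deriv_deriv_eqOn_Ioo ((pathExt_of_mem h).mono Set.Ioo_subset_Icc_self) ht]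

lemma Spline30_subset_C2paths : Spline30 d N ⊆ C2paths d N :=
  fun _ ⟨f, hf, h, _⟩ => ⟨f, hf, h⟩

lemma energy_le_of_mem_Spline30 {σ ω : PathSpace d N} (hσ : σ ∈ Spline30 d N)
    (hω : ω ∈ C2paths d N) (hknot : knotValues d N ω = knotValues d N σ) :
    energy d N σ ≤ energy d N ω := by
  obtain ⟨f, hf, hσf, hcub, hl, hr⟩ := hσ
  obtain ⟨g, hg, hωg⟩ := hω
  have hs : IsNaturalSpline N f := ⟨hf, hcub, hl, hr⟩
  rw [energy_eq hσf, energy_eq hωg, hs.integral_norm_sq_eq hg fun i => by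
    rw [← knotValues_eq hωg, ← knotValues_eq hσf, hknot]]
  exact le_add_of_nonneg_right <|
    intervalIntegral.integral_nonneg (Nat.cast_nonneg N) fun _ _ => by positivity

lemma eq_of_mem_Spline30_of_energy_le (hN : 1 ≤ N) {σ ω : PathSpace d N}
    (hσ : σ ∈ Spline30 d N) (hω : ω ∈ C2paths d N)
    (hknot : knotValues d N ω = knotValues d N σ) (hle : energy d N ω ≤ energy d N σ) :
    ω = σ := by
  obtain ⟨f, hf, hσf, hcub, hl, hr⟩ := hσ
  obtain ⟨g, hg, hωg⟩ := hω
  have hs : IsNaturalSpline N f := ⟨hf, hcub, hl, hr⟩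
  rw [energy_eq hσf, energy_eq hωg] at hle
  ext1 t
  rw [hωg, hσf]
  exact hs.eqOn_of_integral_le hN hg
    (fun i => by rw [← knotValues_eq hωg, ← knotValues_eq hσf, hknot]) hle t.2

lemma eq_of_mem_Spline30 (hN : 1 ≤ N) {σ ω : PathSpace d N} (hσ : σ ∈ Spline30 d N)
    (hω : ω ∈ Spline30 d N) (hknot : knotValues d N ω = knotValues d N σ) : ω = σ :=
  eq_of_mem_Spline30_of_energy_le hN hσ (Spline30_subset_C2paths hω) hknot
    (energy_le_of_mem_Spline30 hω (Spline30_subset_C2paths hσ) hknot.symm)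

lemma multiCost_knotValues {σ : PathSpace d N} (hσ : σ ∈ Spline30 d N) :
    multiCost N (knotValues d N σ) = energy d N σ := by
  refine IsLeast.csInf_eq ⟨?_, ?_⟩
  · obtain ⟨f, hf, hσf, -⟩ := hσ
    exact ⟨f, hf, fun i => (knotValues_eq hσf i).symm, energy_eq hσf⟩
  · rintro _ ⟨X, hX, hXknot, rfl⟩
    have hω : ∀ t : Set.Icc (0 : ℝ) (N : ℝ), restrictPath (N := N) hX.continuous t = X t :=
      fun _ => rfl
    rw [← energy_eq hω]
    exact energy_le_of_mem_Spline30 hσ ⟨X, hX, hω⟩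
      (funext fun i => (knotValues_eq hω i).trans (hXknot i))

/-- Natural spline interpolation as a continuous map into path space. -/
lemma exists_splinePath (d : ℕ) {N : ℕ} (hN : 1 ≤ N) :
    ∃ s : (Fin (N + 1) → EuclideanSpace ℝ (Fin d)) → PathSpace d N, Continuous s ∧
      (∀ x, s x ∈ Spline30 d N) ∧ (∀ x, knotValues d N (s x) = x) ∧
      (Continuous fun x => energy d N (s x)) ∧
      ∃ K, 0 ≤ K ∧ ∀ x, energy d N (s x) ≤ K * ‖x‖ ^ 2 := by
  obtain ⟨L, hL⟩ := exists_spline_coeff (E := EuclideanSpace ℝ (Fin d)) hN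
  have hs : ∀ x, ∀ t : Set.Icc (0 : ℝ) (N : ℝ),
      restrictPath (N := N) (hL x).1.contDiff.continuous t = truncatedSpline (L x) t :=
    fun _ _ => rfl
  have henergy : ∀ x, energy d N (restrictPath (N := N) (hL x).1.contDiff.continuous) =
      ∫ t in (0 : ℝ)..N, ‖truncatedSplineDeriv₂ (L x) t‖ ^ 2 := fun x => by
    rw [energy_eq (hs x), deriv_deriv_truncatedSpline]
  have hcont : Continuous fun p : (Fin (N + 1) → EuclideanSpace ℝ (Fin d)) × ℝ =>
      truncatedSplineDeriv₂ (L p.1) p.2 :=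
    (continuous_truncatedSplineDeriv₂ N).comp
      ((L.continuous.comp continuous_fst).prodMk continuous_snd)
  refine ⟨fun x => restrictPath (N := N) (hL x).1.contDiff.continuous, ?_, ?_, ?_, ?_,
    N * ((N + 1) * (6 * N) * ‖L‖) ^ 2, by positivity, ?_⟩
  · exact ContinuousMap.continuous_of_continuous_uncurry _ <|
      (continuous_truncatedSpline N).comp
        ((L.continuous.comp continuous_fst).prodMk (continuous_subtype_val.comp continuous_snd))
  · exact fun x => ⟨truncatedSpline (L x), (hL x).1.contDiff, hs x, (hL x).1.cubic, (hL x).1.left,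
      (hL x).1.right⟩
  · exact fun x => funext fun i => (knotValues_eq (hs x) i).trans ((hL x).2 i)
  · simp_rw [henergy]
    exact intervalIntegral.continuous_parametric_intervalIntegral_of_continuous'
      (f := fun x t => ‖truncatedSplineDeriv₂ (L x) t‖ ^ 2) (by fun_prop) _ _
  · intro x
    rw [henergy]
    have hbound : ∀ t ∈ Set.Icc 0 (N : ℝ), ‖truncatedSplineDeriv₂ (L x) t‖ ^ 2 ≤
        ((N + 1) * (6 * N) * ‖L‖) ^ 2 * ‖x‖ ^ 2 := by
      intro t ht
      rw [← mul_pow, mul_assoc _ ‖L‖]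
      gcongr
      exact (norm_truncatedSplineDeriv₂_le (L x) ht).trans (by gcongr; exact L.le_opNorm x)
    have hint : Continuous fun t => ‖truncatedSplineDeriv₂ (L x) t‖ ^ 2 :=
      (hcont.comp (Continuous.prodMk_right x)).norm.pow 2
    refine (intervalIntegral.integral_mono_on (Nat.cast_nonneg N)
      (hint.intervalIntegrable _ _) intervalIntegrable_const hbound).trans_eq ?_
    simp only [intervalIntegral.integral_const, sub_zero, smul_eq_mul, mul_assoc]

end Paths

section Measurability

variable {d N : ℕ}

/-- The curve on `ℝ` with initial position `p.1`, initial velocity `p.2.1` and whose acceleration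
is the clamped extension of `p.2.2`. -/
def curveOfAccel (p : EuclideanSpace ℝ (Fin d) × EuclideanSpace ℝ (Fin d) × PathSpace d N)
    (t : ℝ) : EuclideanSpace ℝ (Fin d) :=
  p.1 + ∫ u in (0 : ℝ)..t, (p.2.1 + ∫ s in (0 : ℝ)..u, pathExt d N p.2.2 s)

lemma continuous_pathExt_uncurry :
    Continuous fun p : PathSpace d N × ℝ => pathExt d N p.1 p.2 := by
  have h : Continuous (Set.projIcc (0 : ℝ) (N : ℝ) (Nat.cast_nonneg N)) := continuous_projIcc
  exact continuous_eval.comp (continuous_fst.prodMk (h.comp continuous_snd))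

lemma continuous_pathExt (ω : PathSpace d N) : Continuous (pathExt d N ω) :=
  continuous_pathExt_uncurry.comp (Continuous.prodMk_right ω)

lemma continuous_velocity :
    Continuous fun q : (EuclideanSpace ℝ (Fin d) × EuclideanSpace ℝ (Fin d) × PathSpace d N) × ℝ =>
      q.1.2.1 + ∫ s in (0 : ℝ)..q.2, pathExt d N q.1.2.2 s := by
  refine (by fun_prop : Continuous fun q : (EuclideanSpace ℝ (Fin d) × EuclideanSpace ℝ (Fin d) ×
    PathSpace d N) × ℝ => q.1.2.1).add ?_
  exact intervalIntegral.continuous_parametric_intervalIntegral_of_continuous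
    (f := fun (q : (EuclideanSpace ℝ (Fin d) × EuclideanSpace ℝ (Fin d) × PathSpace d N) × ℝ) s =>
      pathExt d N q.1.2.2 s)
    (continuous_pathExt_uncurry.comp (by fun_prop :
      Continuous fun r : ((EuclideanSpace ℝ (Fin d) × EuclideanSpace ℝ (Fin d) ×
        PathSpace d N) × ℝ) × ℝ => (r.1.1.2.2, r.2))) continuous_snd

lemma continuous_curveOfAccel :
    Continuous fun q : (EuclideanSpace ℝ (Fin d) × EuclideanSpace ℝ (Fin d) × PathSpace d N) × ℝ =>
      curveOfAccel q.1 q.2 := by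
  unfold curveOfAccel
  refine (by fun_prop : Continuous fun q : (EuclideanSpace ℝ (Fin d) × EuclideanSpace ℝ (Fin d) ×
    PathSpace d N) × ℝ => q.1.1).add ?_
  exact intervalIntegral.continuous_parametric_intervalIntegral_of_continuous
    (f := fun (q : (EuclideanSpace ℝ (Fin d) × EuclideanSpace ℝ (Fin d) × PathSpace d N) × ℝ) u =>
      q.1.2.1 + ∫ s in (0 : ℝ)..u, pathExt d N q.1.2.2 s)
    (continuous_velocity.comp (by fun_prop :
      Continuous fun r : ((EuclideanSpace ℝ (Fin d) × EuclideanSpace ℝ (Fin d) ×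
        PathSpace d N) × ℝ) × ℝ => (r.1.1, r.2))) continuous_snd

lemma hasDerivAt_curveOfAccel
    (p : EuclideanSpace ℝ (Fin d) × EuclideanSpace ℝ (Fin d) × PathSpace d N) (t : ℝ) :
    HasDerivAt (curveOfAccel p) (p.2.1 + ∫ s in (0 : ℝ)..t, pathExt d N p.2.2 s) t :=
  ((continuous_velocity.comp (Continuous.prodMk_right p)).integral_hasStrictDerivAt 0
    t).hasDerivAt.const_add p.1

lemma hasDerivAt_velocity
    (p : EuclideanSpace ℝ (Fin d) × EuclideanSpace ℝ (Fin d) × PathSpace d N) (t : ℝ) :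
    HasDerivAt (fun t => p.2.1 + ∫ s in (0 : ℝ)..t, pathExt d N p.2.2 s) (pathExt d N p.2.2 t) t :=
  ((continuous_pathExt p.2.2).integral_hasStrictDerivAt 0 t).hasDerivAt.const_add p.2.1

lemma contDiff_curveOfAccel
    (p : EuclideanSpace ℝ (Fin d) × EuclideanSpace ℝ (Fin d) × PathSpace d N) :
    ContDiff ℝ 2 (curveOfAccel p) :=
  contDiff_two_of_hasDerivAt (hasDerivAt_curveOfAccel p) (hasDerivAt_velocity p)
    (continuous_pathExt _)

/-- The twice differentiable path with given initial position, initial velocity and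
acceleration. -/
def pathOfAccel (p : EuclideanSpace ℝ (Fin d) × EuclideanSpace ℝ (Fin d) × PathSpace d N) :
    PathSpace d N :=
  restrictPath (contDiff_curveOfAccel p).continuous

lemma continuous_pathOfAccel : Continuous (pathOfAccel (d := d) (N := N)) :=
  ContinuousMap.continuous_of_continuous_uncurry _ <|
    continuous_curveOfAccel.comp
      (continuous_fst.prodMk (continuous_subtype_val.comp continuous_snd))

lemma injective_pathOfAccel (hN : 1 ≤ N) : Function.Injective (pathOfAccel (d := d) (N := N)) := by
  intro p q hpq
  have hN' : (0 : ℝ) < N := by exact_mod_cast hN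
  have heq : Set.EqOn (curveOfAccel p) (curveOfAccel q) (Set.Icc 0 N) :=
    fun t ht => DFunLike.congr_fun hpq ⟨t, ht⟩
  have h₁ := deriv_eqOn_Icc hN' (contDiff_curveOfAccel p).contDiff_deriv_of_two.continuous
    (contDiff_curveOfAccel q).contDiff_deriv_of_two.continuous heq
  have h₂ := deriv_deriv_eqOn_Icc hN' (contDiff_curveOfAccel p) (contDiff_curveOfAccel q) heq
  rw [deriv_deriv_eq_of_hasDerivAt (hasDerivAt_curveOfAccel p) (hasDerivAt_velocity p),
    deriv_deriv_eq_of_hasDerivAt (hasDerivAt_curveOfAccel q) (hasDerivAt_velocity q)] at h₂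
  rw [deriv_eq (hasDerivAt_curveOfAccel p), deriv_eq (hasDerivAt_curveOfAccel q)] at h₁
  refine Prod.ext ?_ (Prod.ext ?_ (ContinuousMap.ext fun t => ?_))
  · simpa [curveOfAccel] using heq (x := 0) ⟨le_rfl, hN'.le⟩
  · simpa using h₁ (x := 0) ⟨le_rfl, hN'.le⟩
  · have h := h₂ t.2
    rwa [pathExt, pathExt, Set.projIcc_of_mem _ t.2] at h

lemma range_pathOfAccel : Set.range (pathOfAccel (d := d) (N := N)) = C2paths d N := by
  ext ω
  constructor
  · rintro ⟨p, rfl⟩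
    exact ⟨curveOfAccel p, contDiff_curveOfAccel p, fun _ => rfl⟩
  · rintro ⟨f, hf, hωf⟩
    have hf₂ := hf.continuous_deriv_deriv_of_two
    refine ⟨(f 0, deriv f 0, restrictPath hf₂), ContinuousMap.ext fun t => ?_⟩
    have hext : Set.EqOn (pathExt d N (restrictPath hf₂)) (deriv (deriv f)) (Set.Icc 0 N) :=
      pathExt_of_mem fun _ => rfl
    have hvel : ∀ u ∈ Set.Icc 0 (N : ℝ),
        deriv f 0 + ∫ s in (0 : ℝ)..u, pathExt d N (restrictPath hf₂) s = deriv f u := by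
      intro u hu
      rw [intervalIntegral.integral_congr (g := deriv (deriv f)) fun s hs => by
          rw [Set.uIcc_of_le hu.1] at hs
          exact hext ⟨hs.1, hs.2.trans hu.2⟩,
        intervalIntegral.integral_eq_sub_of_hasDerivAt
          (fun s _ => hf.hasDerivAt_deriv_of_two s) (hf₂.intervalIntegrable _ _),
        add_sub_cancel]
    rw [hωf]
    change f 0 + ∫ u in (0 : ℝ)..t,
      (deriv f 0 + ∫ s in (0 : ℝ)..u, pathExt d N (restrictPath hf₂) s) = f t
    rw [intervalIntegral.integral_congr (g := deriv f) fun u hu => by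
        rw [Set.uIcc_of_le t.2.1] at hu
        exact hvel u ⟨hu.1, hu.2.trans t.2.2⟩,
      intervalIntegral.integral_eq_sub_of_hasDerivAt (fun s _ => hf.hasDerivAt_of_two s)
        (hf.contDiff_deriv_of_two.continuous.intervalIntegrable _ _),
      add_sub_cancel]

lemma measurableEmbedding_pathOfAccel (hN : 1 ≤ N) :
    MeasurableEmbedding (pathOfAccel (d := d) (N := N)) :=
  continuous_pathOfAccel.measurableEmbedding (injective_pathOfAccel hN)

lemma measurableSet_C2paths (hN : 1 ≤ N) : MeasurableSet (C2paths d N) := by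
  rw [← range_pathOfAccel]
  exact (measurableEmbedding_pathOfAccel hN).measurableSet_range

lemma exists_measurable_eqOn_energy (d : ℕ) {N : ℕ} (hN : 1 ≤ N) :
    ∃ e : PathSpace d N → ℝ, Measurable e ∧ Set.EqOn e (energy d N) (C2paths d N) := by
  have henergy : ∀ p, energy d N (pathOfAccel p) = ∫ t in (0 : ℝ)..N, ‖pathExt d N p.2.2 t‖ ^ 2 :=
    fun p => by
      rw [energy_eq (f := curveOfAccel p) fun _ => rfl,
        deriv_deriv_eq_of_hasDerivAt (hasDerivAt_curveOfAccel p) (hasDerivAt_velocity p)]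
  have hcont : Continuous fun p => energy d N (pathOfAccel p) := by
    simp_rw [henergy]
    exact intervalIntegral.continuous_parametric_intervalIntegral_of_continuous'
      (f := fun (p : EuclideanSpace ℝ (Fin d) × EuclideanSpace ℝ (Fin d) × PathSpace d N) t =>
        ‖pathExt d N p.2.2 t‖ ^ 2)
      ((continuous_pow 2).comp (continuous_pathExt_uncurry.comp (by fun_prop :
        Continuous fun r : (EuclideanSpace ℝ (Fin d) × EuclideanSpace ℝ (Fin d) ×
          PathSpace d N) × ℝ => (r.1.2.2, r.2))).norm) _ _
  obtain ⟨e, he, heq⟩ := (measurableEmbedding_pathOfAccel hN).exists_measurable_extend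
    hcont.measurable fun _ => inferInstance
  refine ⟨e, he, ?_⟩
  rw [← range_pathOfAccel]
  rintro _ ⟨p, rfl⟩
  exact congrFun heq p

lemma measurableSet_Spline30 (hN : 1 ≤ N) : MeasurableSet (Spline30 d N) := by
  obtain ⟨s, hs, hspline, hknot, -⟩ := exists_splinePath d hN
  have h : Spline30 d N = {ω | s (knotValues d N ω) = ω} := by
    ext ω
    refine ⟨fun hω => eq_of_mem_Spline30 hN hω (hspline _) (hknot _), fun hω => ?_⟩
    have hω' : s (knotValues d N ω) = ω := hω
    rw [← hω']
    exact hspline _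
  rw [h]
  exact (isClosed_eq (hs.comp continuous_knotValues) continuous_id).measurableSet

end Measurability

lemma lintegral_ofReal_mul_norm_sq_lt_top {E ι : Type*} [NormedAddCommGroup E]
    [MeasurableSpace E] [BorelSpace E] [Fintype ι] {ρ : ι → Measure E}
    (hmom : ∀ i, ∫⁻ z, ENNReal.ofReal (‖z‖ ^ 2) ∂(ρ i) < ⊤) {π : Measure (ι → E)}
    (hπ : ∀ i, π.map (fun y => y i) = ρ i) {K : ℝ} (hK : 0 ≤ K) :
    ∫⁻ y, ENNReal.ofReal (K * ‖y‖ ^ 2) ∂π < ⊤ := by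
  have hle : ∀ y : ι → E, ENNReal.ofReal (K * ‖y‖ ^ 2) ≤
      ∑ i, ENNReal.ofReal K * ENNReal.ofReal (‖y i‖ ^ 2) := by
    intro y
    rw [← Finset.mul_sum, ENNReal.ofReal_mul hK, ← ENNReal.ofReal_sum_of_nonneg
      fun _ _ => by positivity]
    gcongr
    have hsum : 0 ≤ ∑ i, ‖y i‖ ^ 2 := Finset.sum_nonneg fun _ _ => by positivity
    rw [← Real.le_sqrt (norm_nonneg _) hsum]
    exact (pi_norm_le_iff_of_nonneg (Real.sqrt_nonneg _)).2 fun i =>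
      Real.le_sqrt_of_sq_le (Finset.single_le_sum (f := fun i => ‖y i‖ ^ 2)
        (fun _ _ => by positivity) (Finset.mem_univ i))
  have hmeas : Measurable fun z : E => ENNReal.ofReal (‖z‖ ^ 2) := by fun_prop
  refine (lintegral_mono hle).trans_lt ?_
  rw [lintegral_finsetSum _ fun i _ => by fun_prop]
  refine ENNReal.sum_lt_top.2 fun i _ => ?_
  rw [lintegral_const_mul _ (by fun_prop), ← lintegral_map hmeas (measurable_pi_apply i), hπ]
  exact ENNReal.mul_lt_top ENNReal.ofReal_lt_top (hmom i)

/-- An admissible measure `P̂` (a probability measure on path space concentrated on C²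
paths, with time-`i` marginals `ρ i`) minimizes the mean-squared acceleration among
admissible measures iff `P̂(𝒮₃⁰) = 1` and the joint law of the evaluations at integer
times minimizes `∫ 𝒞 dπ` over `Π(ρ₀,…,ρ_N)`. -/
theorem stmt7 (d N : ℕ) (hd : 1 ≤ d) (hN : 1 ≤ N)
    (ρ : Fin (N + 1) → Measure (EuclideanSpace ℝ (Fin d)))
    (hprob : ∀ i, IsProbabilityMeasure (ρ i))
    (hmom : ∀ i, (∫⁻ z, ENNReal.ofReal (‖z‖ ^ 2) ∂(ρ i)) < ⊤)
    (P : Measure (PathSpace d N)) (hP : IsProbabilityMeasure P)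
    (hP2 : P (C2paths d N) = 1)
    (hPx : ∀ i : Fin (N + 1),
      P.map (fun ω => pathExt d N ω ((i : ℕ) : ℝ)) = ρ i) :
    ((∀ P' : Measure (PathSpace d N), IsProbabilityMeasure P' →
        P' (C2paths d N) = 1 →
        (∀ i : Fin (N + 1), P'.map (fun ω => pathExt d N ω ((i : ℕ) : ℝ)) = ρ i) →
        (∫⁻ ω, ENNReal.ofReal (energy d N ω) ∂P) ≤
          ∫⁻ ω, ENNReal.ofReal (energy d N ω) ∂P')
      ↔
      (P (Spline30 d N) = 1 ∧
        ∀ π' : Measure (Fin (N + 1) → EuclideanSpace ℝ (Fin d)),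
          IsProbabilityMeasure π' → (∀ i, π'.map (fun y => y i) = ρ i) →
          (∫⁻ y, ENNReal.ofReal (multiCost N y)
              ∂(P.map (fun ω (i : Fin (N + 1)) => pathExt d N ω ((i : ℕ) : ℝ)))) ≤
            ∫⁻ y, ENNReal.ofReal (multiCost N y) ∂π')) := by
  obtain ⟨s, hs, hspline, hknot, hcost_cont, K, hK, hbound⟩ := exists_splinePath d hN
  change _ ↔ _ ∧ ∀ π' : Measure (Fin (N + 1) → EuclideanSpace ℝ (Fin d)), _ → _ →
    ∫⁻ y, ENNReal.ofReal (multiCost N y) ∂(P.map (knotValues d N)) ≤ _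
  have hev : Measurable (knotValues d N) := continuous_knotValues.measurable
  have hcost : ∀ x : Fin (N + 1) → EuclideanSpace ℝ (Fin d),
      multiCost N x = energy d N (s x) := fun x => by
    rw [← multiCost_knotValues (hspline x), hknot]
  have hcost_meas : Measurable fun x : Fin (N + 1) → EuclideanSpace ℝ (Fin d) =>
      ENNReal.ofReal (multiCost N x) := by
    simp_rw [hcost]
    exact ENNReal.measurable_ofReal.comp hcost_cont.measurable
  have hcost_le : ∀ ω ∈ C2paths d N, multiCost N (knotValues d N ω) ≤ energy d N ω := by
    intro ω hω
    rw [hcost]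
    exact energy_le_of_mem_Spline30 (hspline _) hω (hknot _).symm
  have hlift : ∀ π : Measure (Fin (N + 1) → EuclideanSpace ℝ (Fin d)), IsProbabilityMeasure π →
      (∀ i, π.map (fun y => y i) = ρ i) →
      IsProbabilityMeasure (π.map s) ∧ π.map s (C2paths d N) = 1 ∧
      (∀ i : Fin (N + 1), (π.map s).map (fun ω => pathExt d N ω ((i : ℕ) : ℝ)) = ρ i) ∧
      ∫⁻ ω, ENNReal.ofReal (energy d N ω) ∂(π.map s) ≤
        ∫⁻ y, ENNReal.ofReal (multiCost N y) ∂π := by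
    intro π hπ hmarg
    refine ⟨Measure.isProbabilityMeasure_map hs.aemeasurable, ?_, fun i => ?_, ?_⟩
    · have huniv : s ⁻¹' C2paths d N = Set.univ :=
        Set.eq_univ_of_forall fun x => Spline30_subset_C2paths (hspline x)
      rw [Measure.map_apply hs.measurable (measurableSet_C2paths hN), huniv, measure_univ]
    · rw [Measure.map_map (continuous_pathExt_apply _).measurable hs.measurable, ← hmarg i]
      exact congrArg (fun f => π.map f) (funext fun x => congrFun (hknot x) i)
    · refine (lintegral_map_le _ _).trans_eq ?_
      simp_rw [hcost]
  have hpush : ∀ P' : Measure (PathSpace d N),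
      (∀ i : Fin (N + 1), P'.map (fun ω => pathExt d N ω ((i : ℕ) : ℝ)) = ρ i) →
      ∀ i, (P'.map (knotValues d N)).map (fun y => y i) = ρ i := by
    intro P' hmarg i
    rw [Measure.map_map (measurable_pi_apply i) hev, ← hmarg i]
    rfl
  have hproj : ∀ P' : Measure (PathSpace d N), IsProbabilityMeasure P' →
      P' (C2paths d N) = 1 →
      ∫⁻ y, ENNReal.ofReal (multiCost N y) ∂(P'.map (knotValues d N)) ≤
        ∫⁻ ω, ENNReal.ofReal (energy d N ω) ∂P' := by
    intro P' hP' hC2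
    rw [lintegral_map hcost_meas hev]
    refine lintegral_mono_ae ?_
    filter_upwards [(mem_ae_iff_prob_eq_one (measurableSet_C2paths hN)).2 hC2] with ω hω
    exact ENNReal.ofReal_le_ofReal (hcost_le ω hω)
  have hP2_ae : ∀ᵐ ω ∂P, ω ∈ C2paths d N :=
    (mem_ae_iff_prob_eq_one (measurableSet_C2paths hN)).2 hP2
  constructor
  · intro hopt
    constructor
    · have hprobπ := Measure.isProbabilityMeasure_map (μ := P) hev.aemeasurable
      obtain ⟨h₁, h₂, h₃, h₄⟩ := hlift (P.map (knotValues d N)) hprobπ (hpush P hPx)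
      have hle := (hopt _ h₁ h₂ h₃).trans h₄
      have hfin : ∫⁻ y, ENNReal.ofReal (multiCost N y) ∂(P.map (knotValues d N)) ≠ ⊤ :=
        ((lintegral_mono fun y => ENNReal.ofReal_le_ofReal
          ((hcost y).trans_le (hbound y))).trans_lt
            (lintegral_ofReal_mul_norm_sq_lt_top hmom (hpush P hPx) hK)).ne
      rw [lintegral_map hcost_meas hev] at hle hfin
      obtain ⟨e, he, heq⟩ := exists_measurable_eqOn_energy d hN
      have hmeas : AEMeasurable (fun ω => ENNReal.ofReal (energy d N ω)) P :=
        ⟨fun ω => ENNReal.ofReal (e ω), he.ennreal_ofReal, by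
          filter_upwards [hP2_ae] with ω hω
          rw [heq hω]⟩
      have hae := ae_eq_of_ae_le_of_lintegral_le (by
        filter_upwards [hP2_ae] with ω hω
        exact ENNReal.ofReal_le_ofReal (hcost_le ω hω)) hfin hmeas hle
      refine (mem_ae_iff_prob_eq_one (measurableSet_Spline30 hN)).1 ?_
      filter_upwards [hP2_ae, hae] with ω hω hωe
      have hcost_nonneg : 0 ≤ multiCost N (knotValues d N ω) := by
        rw [hcost]
        exact intervalIntegral.integral_nonneg (Nat.cast_nonneg N) fun _ _ => by positivity
      have henergy : energy d N ω ≤ energy d N (s (knotValues d N ω)) := by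
        rw [← hcost]
        exact (ENNReal.ofReal_le_ofReal_iff hcost_nonneg).1 hωe.ge
      rw [eq_of_mem_Spline30_of_energy_le hN (hspline _) hω (hknot _).symm henergy]
      exact hspline _
    · intro π' hπ' hmarg
      obtain ⟨h₁, h₂, h₃, h₄⟩ := hlift π' hπ' hmarg
      exact (hproj P hP hP2).trans ((hopt _ h₁ h₂ h₃).trans h₄)
  · rintro ⟨hS, hopt⟩ P' hP' hC2 hmarg
    calc ∫⁻ ω, ENNReal.ofReal (energy d N ω) ∂P
        = ∫⁻ ω, ENNReal.ofReal (multiCost N (knotValues d N ω)) ∂P := by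
          refine lintegral_congr_ae ?_
          filter_upwards [(mem_ae_iff_prob_eq_one (measurableSet_Spline30 hN)).2 hS] with ω hω
          rw [multiCost_knotValues hω]
      _ = ∫⁻ y, ENNReal.ofReal (multiCost N y) ∂(P.map (knotValues d N)) :=
          (lintegral_map hcost_meas hev).symm
      _ ≤ ∫⁻ y, ENNReal.ofReal (multiCost N y) ∂(P'.map (knotValues d N)) :=
          hopt _ (Measure.isProbabilityMeasure_map hev.aemeasurable) (hpush P' hmarg)
      _ ≤ ∫⁻ ω, ENNReal.ofReal (energy d N ω) ∂P' := hproj P' hP' hC2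
end
end
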